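/- Theorem (uniqueness of primitive generators): For any word c̄ over an alphabet A, if ā and b̄ are both primitive generators of c̄, then b̄ = ā or b̄ = ā⁻¹. -/

import Mathlib

/-- A function `f : {1,…,m} → {1,…,k}` (0-indexed here) is adjacent if the
indices of consecutive values differ by at most 1. -/
def Adjacent {m k : ℕ} (f : Fin m → Fin k) : Prop :=
  ∀ (i : ℕ) (h : i + 1 < m),
    |(((f ⟨i + 1, h⟩ : Fin k) : ℕ) : ℤ) - (((f ⟨i, Nat.lt_of_succ_lt h⟩ : Fin k) : ℕ) : ℤ)| ≤ 1

/-- A word `a` generates a word `c` if `c = a^f` for some surjective adjacent `f`. -/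
def Generates {A : Type*} (a c : List A) : Prop :=
  ∃ f : Fin c.length → Fin a.length,
    Adjacent f ∧ Function.Surjective f ∧ c = List.ofFn (fun i => a.get (f i))

/-- A word is primitive if it is not generated by any strictly shorter word. -/
def Primitive {A : Type*} (a : List A) : Prop :=
  ¬ ∃ b : List A, b.length < a.length ∧ Generates b a

/-- A primitive generator of `c` is a generator of `c` that is primitive. -/
def PrimitiveGenerator {A : Type*} (a c : List A) : Prop :=
  Primitive a ∧ Generates a c

/-- `f` is a surjective adjacent walk on the word `a 0 ⋯ a k` spelling the word `c 0 ⋯ c n`. -/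
structure IsWalk {A : Type*} (a : ℕ → A) (k : ℕ) (c : ℕ → A) (n : ℕ) (f : ℕ → ℕ) : Prop where
  le : ∀ i ≤ n, f i ≤ k
  adj : ∀ i < n, f (i + 1) ≤ f i + 1 ∧ f i ≤ f (i + 1) + 1
  surj : ∀ p ≤ k, ∃ i ≤ n, f i = p
  eq : ∀ i ≤ n, c i = a (f i)

/-- No walk on a strictly shorter word spells `a 0 ⋯ a k`. -/
def PrimitiveFn {A : Type*} (a : ℕ → A) (k : ℕ) : Prop :=
  ∀ (b : ℕ → A) (l : ℕ) (f : ℕ → ℕ), IsWalk b l a k f → k ≤ l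

/-- The word `c 0 ⋯ c n` contains an odd palindrome of radius `r` centred at `i`. -/
def SymAt {A : Type*} (c : ℕ → A) (n i r : ℕ) : Prop :=
  r ≤ i ∧ i + r ≤ n ∧ ∀ s ≤ r, c (i - s) = c (i + s)

/-- The word `c 0 ⋯ c n` has an odd palindrome of radius `l` at its start or at its end, or two such
palindromes at distance `l`. -/
def HasFold {A : Type*} (c : ℕ → A) (n l : ℕ) : Prop :=
  1 ≤ l ∧ (SymAt c n l l ∨ SymAt c n (n - l) l ∨ ∃ i, SymAt c n i l ∧ SymAt c n (i + l) l)

/-- Delete the letters of `c` at the positions `x + 1, …, x + d`. -/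
def cut {A : Type*} (c : ℕ → A) (x d : ℕ) : ℕ → A :=
  fun s => if s ≤ x then c s else c (s + d)

/-- Consecutive letters of `c 0 ⋯ c n` are distinct. -/
def StutterFree {A : Type*} (c : ℕ → A) (n : ℕ) : Prop := ∀ i < n, c i ≠ c (i + 1)

/-- The function `f` moves with constant speed `1` or `-1` on the interval `[x, x + m]`. -/
def StraightOn (f : ℕ → ℕ) (x m : ℕ) : Prop :=
  (∀ s ≤ m, f (x + s) = f x + s) ∨ (∀ s ≤ m, f (x + s) + s = f x)

section Words

variable {A : Type*} {a b c : ℕ → A} {k l n i r : ℕ} {f : ℕ → ℕ}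

theorem PrimitiveFn.stutterFree (ha : PrimitiveFn a k) : StutterFree a k := by
  intro i hi h
  have := ha (cut a i 1) (k - 1) (fun s => if s ≤ i then s else s - 1)
    { le := by intro s hs; split_ifs <;> omega
      adj := by intro s hs; split_ifs <;> omega
      surj := by
        intro p hp
        by_cases h : p ≤ i
        · exact ⟨p, by omega, by simp [h]⟩
        · exact ⟨p + 1, by omega, by split_ifs <;> omega⟩
      eq := by
        intro s hs
        simp only [cut]
        split_ifs
        · rfl
        · have : s = i + 1 := by omega
          subst this; simpa using h.symm
        · congr 1; omega }
  omega

theorem PrimitiveFn.not_symAt_start (ha : PrimitiveFn a k) (hl : 1 ≤ l) : ¬ SymAt a k l l := by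
  rintro ⟨-, h1, h2⟩
  have := ha (fun s => a (s + l)) (k - l) (fun s => if s ≤ l then l - s else s - l)
    { le := by intro s hs; split_ifs <;> omega
      adj := by intro s hs; split_ifs <;> omega
      surj := by
        intro p hp
        exact ⟨p + l, by omega, by split_ifs <;> omega⟩
      eq := by
        intro s hs
        split_ifs with h
        · have := h2 (l - s) (by omega)
          rw [show l - (l - s) = s by omega] at this
          rw [this]; congr 1; omega
        · congr 1; omega }
  omega

theorem PrimitiveFn.not_symAt_last (ha : PrimitiveFn a k) (hl : 1 ≤ l) :
    ¬ SymAt a k (k - l) l := by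
  rintro ⟨h0, h1, h2⟩
  have := ha a (k - l) (fun s => if s ≤ k - l then s else 2 * (k - l) - s)
    { le := by intro s hs; split_ifs <;> omega
      adj := by intro s hs; split_ifs <;> omega
      surj := by
        intro p hp
        exact ⟨p, by omega, by split_ifs; omega⟩
      eq := by
        intro s hs
        split_ifs with h
        · rfl
        · have := h2 (s - (k - l)) (by omega)
          rw [show k - l + (s - (k - l)) = s by omega] at this
          rw [← this]; congr 1; omega }
  omega

/-- In a zigzag, the letters repeat with period twice the distance of the two centres. -/
theorem SymAt.periodic (h : SymAt c n i l) (h' : SymAt c n (i + l) l) {s : ℕ} (hs : s ≤ l) :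
    c (i - s) = c (i - s + 2 * l) := by
  have e1 := h.2.2 s hs
  have e2 := h'.2.2 (l - s) (by omega)
  have := h.1
  rw [e1, show i + s = i + l - (l - s) by omega, e2]
  congr 1; omega

theorem PrimitiveFn.not_zigzag (ha : PrimitiveFn a k) (hl : 1 ≤ l) (h : SymAt a k i l) :
    ¬ SymAt a k (i + l) l := by
  intro h'
  have hp := fun s hs => h.periodic h' (s := s) hs
  obtain ⟨h0, h1, h2⟩ := h
  obtain ⟨h0', h1', h2'⟩ := h'
  have := ha (cut a i (2 * l)) (k - 2 * l)
    (fun s => if s ≤ i then s else if s ≤ i + l then 2 * i - s else s - 2 * l)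
    { le := by intro s hs; split_ifs <;> omega
      adj := by intro s hs; split_ifs <;> omega
      surj := by
        intro p hp
        by_cases h : p ≤ i
        · exact ⟨p, by omega, by simp [h]⟩
        · exact ⟨p + 2 * l, by omega, by split_ifs <;> omega⟩
      eq := by
        intro s hs
        simp only [cut]
        split_ifs with h3 h4 h5 h5
        · rfl
        · have := h2 (s - i) (by omega)
          rw [show i + (s - i) = s by omega] at this
          rw [← this]; congr 1; omega
        · omega
        · have := hp (i + 2 * l - s) (by omega)
          rw [show i - (i + 2 * l - s) = s - 2 * l by omega,
            show s - 2 * l + 2 * l = s by omega] at this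
          exact this.symm
        · congr 1; omega }
  omega

theorem SymAt.hasFold {j : ℕ} (hi : SymAt c n i r) (hj : SymAt c n j r) (hij : i < j)
    (hr : j ≤ i + r) : HasFold c n (j - i) := by
  refine ⟨by omega, Or.inr (Or.inr ⟨i, ⟨?_, ?_, ?_⟩, ?_⟩)⟩
  · have := hi.1; omega
  · have := hi.2.1; omega
  · intro s hs; exact hi.2.2 s (by omega)
  · rw [show i + (j - i) = j by omega]
    refine ⟨?_, ?_, ?_⟩
    · have := hj.1; omega
    · have := hj.2.1; omega
    · intro s hs; exact hj.2.2 s (by omega)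

theorem IsWalk.unit_step (hf : IsWalk a k c n f) (hc : StutterFree c n) (hi : i < n) :
    f (i + 1) = f i + 1 ∨ f i = f (i + 1) + 1 := by
  have h1 := hf.adj i hi
  have h2 : f i ≠ f (i + 1) := by
    intro h
    exact hc i hi (by rw [hf.eq i hi.le, hf.eq (i + 1) hi, h])
  omega

/-- Around a turning point, a walk is symmetric up to the length of the shortest fold. -/
theorem IsWalk.symm_of_turn (hf : IsWalk a k c n f) (hc : StutterFree c n)
    (hl : ∀ m < l, ¬ HasFold c n m) (s : ℕ) (hs : s ≤ l) :
    ∀ t, 0 < t → t < n → f (t - 1) = f (t + 1) →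
      s ≤ t ∧ t + s ≤ n ∧ ∀ u ≤ s, f (t - u) = f (t + u) := by
  induction s with
  | zero =>
    intro t _ _ _
    refine ⟨by omega, by omega, ?_⟩
    intro u hu
    obtain rfl : u = 0 := by omega
    rfl
  | succ s ih =>
    have ih := ih (by omega)
    have sym : ∀ t, 0 < t → t < n → f (t - 1) = f (t + 1) → SymAt c n t s := by
      intro t h1 h2 h3
      obtain ⟨h4, h5, h6⟩ := ih t h1 h2 h3
      refine ⟨h4, h5, fun u hu => ?_⟩
      rw [hf.eq _ (by omega), hf.eq _ (by omega), h6 u hu]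
    intro t h1 h2 h3
    obtain ⟨h4, h5, h6⟩ := ih t h1 h2 h3
    rcases Nat.eq_zero_or_pos s with rfl | hpos
    · refine ⟨by omega, by omega, ?_⟩
      intro u hu
      have : u = 0 ∨ u = 1 := by omega
      rcases this with rfl | rfl
      · rfl
      · exact h3
    have h7 : s < t := by
      by_contra hcon
      obtain rfl : t = s := by omega
      exact hl t (by omega) ⟨hpos, Or.inl (sym t h1 h2 h3)⟩
    have h8 : t + s < n := by
      by_contra hcon
      obtain rfl : t = n - s := by omega
      exact hl s (by omega) ⟨hpos, Or.inr (Or.inl (sym _ h1 h2 h3))⟩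
    have h9 : f (t - s - 1) ≠ f (t - s + 1) := by
      intro h
      have := (sym (t - s) (by omega) (by omega) h).hasFold (sym t h1 h2 h3) (by omega) (by omega)
      rw [show t - (t - s) = s by omega] at this
      exact hl s (by omega) this
    have h10 : f (t + s - 1) ≠ f (t + s + 1) := by
      intro h
      have := (sym t h1 h2 h3).hasFold (sym (t + s) (by omega) (by omega) h) (by omega) (by omega)
      rw [show t + s - t = s by omega] at this
      exact hl s (by omega) this
    refine ⟨by omega, by omega, ?_⟩
    intro u hu
    rcases Nat.lt_or_ge u (s + 1) with hu' | hu'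
    · exact h6 u (by omega)
    obtain rfl : u = s + 1 := by omega
    have e1 := h6 s le_rfl
    have e2 := h6 (s - 1) (by omega)
    have s1 := hf.unit_step hc (i := t - s - 1) (by omega)
    have s2 := hf.unit_step hc (i := t - s) (by omega)
    have s3 := hf.unit_step hc (i := t + s - 1) (by omega)
    have s4 := hf.unit_step hc (i := t + s) (by omega)
    rw [show t - s - 1 + 1 = t - s by omega] at s1
    rw [show t + s - 1 + 1 = t + s by omega] at s3
    rw [show t - (s - 1) = t - s + 1 by omega, show t + (s - 1) = t + s - 1 by omega] at e2
    rw [show t - (s + 1) = t - s - 1 by omega, show t + (s + 1) = t + s + 1 by omega]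
    omega

theorem IsWalk.symAt_of_turn (hf : IsWalk a k c n f) (hc : StutterFree c n)
    (hl : ∀ m < l, ¬ HasFold c n m) {t : ℕ} (h0 : 0 < t) (h1 : t < n)
    (ht : f (t - 1) = f (t + 1)) : SymAt c n t l := by
  obtain ⟨h4, h5, h6⟩ := hf.symm_of_turn hc hl l le_rfl t h0 h1 ht
  refine ⟨h4, h5, fun u hu => ?_⟩
  rw [hf.eq _ (by omega), hf.eq _ (by omega), h6 u hu]

/-- A walk cannot turn close to the centre of a long palindrome. -/
theorem IsWalk.not_turn (hf : IsWalk a k c n f) (hc : StutterFree c n)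
    (hl : ∀ m < l, ¬ HasFold c n m) (hi : SymAt c n i l) {t : ℕ} (h0 : 0 < t) (h1 : t < n)
    (hti : t ≠ i) (h2 : i < t + l) (h3 : t < i + l) : f (t - 1) ≠ f (t + 1) := by
  intro ht
  have hs := hf.symAt_of_turn hc hl h0 h1 ht
  rcases Nat.lt_or_gt_of_ne hti with h | h
  · exact hl _ (by omega) (hs.hasFold hi h (by omega))
  · exact hl _ (by omega) (hi.hasFold hs h (by omega))

theorem IsWalk.straightOn (hf : IsWalk a k c n f) (hc : StutterFree c n) {x m : ℕ}
    (hm : x + m ≤ n) (ht : ∀ t, x < t → t < x + m → f (t - 1) ≠ f (t + 1)) :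
    StraightOn f x m := by
  induction m with
  | zero =>
    left
    intro s hs
    obtain rfl : s = 0 := by omega
    rfl
  | succ m ih =>
    have step := hf.unit_step hc (i := x + m) (by omega)
    rcases Nat.eq_zero_or_pos m with rfl | hpos
    · rcases step with h | h
      · left
        intro s hs
        have : s = 0 ∨ s = 1 := by omega
        rcases this with rfl | rfl
        · rfl
        · exact h
      · right
        intro s hs
        have : s = 0 ∨ s = 1 := by omega
        rcases this with rfl | rfl
        · rfl
        · exact h.symm
    have turn := ht (x + m) (by omega) (by omega)
    rcases ih (by omega) (fun t h1 h2 => ht t h1 (by omega)) with h | h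
    · left
      intro s hs
      rcases Nat.lt_or_ge s (m + 1) with hs' | hs'
      · exact h s (by omega)
      obtain rfl : s = m + 1 := by omega
      have e1 := h m le_rfl
      have e2 := h (m - 1) (by omega)
      rw [show x + (m - 1) = x + m - 1 by omega] at e2
      rw [show x + (m + 1) = x + m + 1 by omega]
      omega
    · right
      intro s hs
      rcases Nat.lt_or_ge s (m + 1) with hs' | hs'
      · exact h s (by omega)
      obtain rfl : s = m + 1 := by omega
      have e1 := h m le_rfl
      have e2 := h (m - 1) (by omega)
      rw [show x + (m - 1) = x + m - 1 by omega] at e2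
      rw [show x + (m + 1) = x + m + 1 by omega]
      omega

/-- A palindrome read along a straight piece of a walk is a palindrome of the generator. -/
theorem IsWalk.symAt_of_straightOn (hf : IsWalk a k c n f) (hi : SymAt c n i l)
    (hs : StraightOn f (i - l) (2 * l)) : SymAt a k (f i) l := by
  obtain ⟨h0, h1, h2⟩ := hi
  have b1 := hf.le (i - l) (by omega)
  have b2 := hf.le (i + l) (by omega)
  have e : ∀ u ≤ l, a (f (i - u)) = a (f (i + u)) := by
    intro u hu
    rw [← hf.eq _ (by omega), ← hf.eq _ (by omega), h2 u hu]
  rcases hs with hs | hs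
  · have g1 : ∀ u ≤ l, f (i + u) = f i + u := by
      intro u hu
      have e1 := hs (l + u) (by omega)
      have e2 := hs l (by omega)
      rw [show i - l + (l + u) = i + u by omega] at e1
      rw [show i - l + l = i by omega] at e2
      omega
    have g2 : ∀ u ≤ l, f (i - u) = f i - u ∧ u ≤ f i := by
      intro u hu
      have e1 := hs (l - u) (by omega)
      have e2 := hs l (by omega)
      rw [show i - l + (l - u) = i - u by omega] at e1
      rw [show i - l + l = i by omega] at e2
      omega
    refine ⟨(g2 l le_rfl).2, by rw [← g1 l le_rfl]; exact b2, fun u hu => ?_⟩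
    rw [← (g2 u hu).1, ← g1 u hu, e u hu]
  · have g1 : ∀ u ≤ l, f (i + u) = f i - u ∧ u ≤ f i := by
      intro u hu
      have e1 := hs (l + u) (by omega)
      have e2 := hs l (by omega)
      rw [show i - l + (l + u) = i + u by omega] at e1
      rw [show i - l + l = i by omega] at e2
      omega
    have g2 : ∀ u ≤ l, f (i - u) = f i + u := by
      intro u hu
      have e1 := hs (l - u) (by omega)
      have e2 := hs l (by omega)
      rw [show i - l + (l - u) = i - u by omega] at e1
      rw [show i - l + l = i by omega] at e2
      omega
    refine ⟨(g1 l le_rfl).2, by rw [← g2 l le_rfl]; exact b1, fun u hu => ?_⟩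
    rw [← (g1 u hu).1, ← g2 u hu, e u hu]

/-- Discrete intermediate value theorem for adjacent functions. -/
theorem exists_eq_of_adjacent {g : ℕ → ℕ} {m : ℕ}
    (hg : ∀ i < m, g (i + 1) ≤ g i + 1 ∧ g i ≤ g (i + 1) + 1) {x y q : ℕ}
    (hx : x ≤ m) (hy : y ≤ m) (h1 : g x ≤ q) (h2 : q ≤ g y) : ∃ i ≤ m, g i = q := by
  by_contra! hcon
  have up : ∀ d, x + d ≤ m → g (x + d) < q := by
    intro d
    induction d with
    | zero => intro _; have := hcon x hx; simp only [Nat.add_zero]; omega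
    | succ d ih =>
      intro hd
      have e1 := ih (by omega)
      have e2 := hg (x + d) (by omega)
      have e3 := hcon (x + (d + 1)) hd
      rw [show x + (d + 1) = x + d + 1 by omega] at *
      omega
  have down : ∀ d, d ≤ x → g (x - d) < q := by
    intro d
    induction d with
    | zero => intro _; have := hcon x hx; simp only [Nat.sub_zero]; omega
    | succ d ih =>
      intro hd
      have e1 := ih (by omega)
      have e2 := hg (x - (d + 1)) (by omega)
      have e3 := hcon (x - (d + 1)) (by omega)
      rw [show x - (d + 1) + 1 = x - d by omega] at e2
      omega
  rcases Nat.le_total x y with h | h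
  · have := up (y - x) (by omega)
    rw [show x + (y - x) = y by omega] at this
    omega
  · have := down (x - y) (by omega)
    rw [show x - (x - y) = y by omega] at this
    omega

/-- If an adjacent function reaches the centre of a palindrome of a primitive word and misses at
most values in one half of this palindrome, then it misses nothing. -/
theorem PrimitiveFn.surj_of_half (ha : PrimitiveFn a k) (hl : 1 ≤ l) {q : ℕ} (hq : SymAt a k q l)
    {g : ℕ → ℕ} {m : ℕ} (hg : ∀ i < m, g (i + 1) ≤ g i + 1 ∧ g i ≤ g (i + 1) + 1)
    (hx : ∃ x ≤ m, g x = q)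
    (h : (∀ p ≤ k, (∃ i ≤ m, g i = p) ∨ (q - l ≤ p ∧ p < q)) ∨
      (∀ p ≤ k, (∃ i ≤ m, g i = p) ∨ (q < p ∧ p ≤ q + l))) :
    ∀ p ≤ k, ∃ i ≤ m, g i = p := by
  obtain ⟨x, hxm, hxq⟩ := hx
  have hq0 := hq.1
  have hq1 := hq.2.1
  intro p hp
  rcases h with h | h
  · rcases h p hp with h' | ⟨h1, h2⟩
    · exact h'
    have hne : q ≠ l := by
      rintro rfl
      exact ha.not_symAt_start hl hq
    rcases h (q - l - 1) (by omega) with ⟨y, hy, hyq⟩ | h'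
    · exact exists_eq_of_adjacent hg hy hxm (by omega) (by omega)
    · omega
  · rcases h p hp with h' | ⟨h1, h2⟩
    · exact h'
    have hne : q ≠ k - l := by
      rintro rfl
      exact ha.not_symAt_last hl hq
    rcases h (q + l + 1) (by omega) with ⟨y, hy, hyq⟩ | h'
    · exact exists_eq_of_adjacent hg hxm hy (by omega) (by omega)
    · omega

/-- Surjectivity of a shortened walk that only loses one half of a straight palindrome. -/
theorem IsWalk.surj_of_straightOn (ha : PrimitiveFn a k) (hf : IsWalk a k c n f) (hl : 1 ≤ l)
    (hi : SymAt c n i l) (hs : StraightOn f (i - l) (2 * l)) {g : ℕ → ℕ} {m : ℕ}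
    (hg : ∀ i < m, g (i + 1) ≤ g i + 1 ∧ g i ≤ g (i + 1) + 1)
    (hx : ∃ x ≤ m, g x = f i)
    (h : (∀ t ≤ n, (∃ i ≤ m, g i = f t) ∨ ∃ s, 1 ≤ s ∧ s ≤ l ∧ f t = f (i + s)) ∨
      (∀ t ≤ n, (∃ i ≤ m, g i = f t) ∨ ∃ s, 1 ≤ s ∧ s ≤ l ∧ f t = f (i - s))) :
    ∀ p ≤ k, ∃ i ≤ m, g i = p := by
  have hq := hf.symAt_of_straightOn hi hs
  refine ha.surj_of_half hl hq hg hx ?_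
  have h0 := hi.1
  have key : ∀ s, 1 ≤ s → s ≤ l →
      f (i - l + l) = f i ∧ f (i - l + (l + s)) = f (i + s) ∧ f (i - l + (l - s)) = f (i - s) := by
    intro s h1 h2
    refine ⟨?_, ?_, ?_⟩ <;> congr 1 <;> omega
  rcases h with h | h <;> rcases hs with hs | hs
  · right
    intro p hp
    obtain ⟨t, ht, rfl⟩ := hf.surj p hp
    refine (h t ht).imp id ?_
    rintro ⟨s, h1, h2, h3⟩
    obtain ⟨k1, k2, k3⟩ := key s h1 h2
    have e1 := hs l (by omega)
    have e2 := hs (l + s) (by omega)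
    omega
  · left
    intro p hp
    obtain ⟨t, ht, rfl⟩ := hf.surj p hp
    refine (h t ht).imp id ?_
    rintro ⟨s, h1, h2, h3⟩
    obtain ⟨k1, k2, k3⟩ := key s h1 h2
    have e1 := hs l (by omega)
    have e2 := hs (l + s) (by omega)
    omega
  · left
    intro p hp
    obtain ⟨t, ht, rfl⟩ := hf.surj p hp
    refine (h t ht).imp id ?_
    rintro ⟨s, h1, h2, h3⟩
    obtain ⟨k1, k2, k3⟩ := key s h1 h2
    have e1 := hs l (by omega)
    have e2 := hs (l - s) (by omega)
    omega
  · right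
    intro p hp
    obtain ⟨t, ht, rfl⟩ := hf.surj p hp
    refine (h t ht).imp id ?_
    rintro ⟨s, h1, h2, h3⟩
    obtain ⟨k1, k2, k3⟩ := key s h1 h2
    have e1 := hs l (by omega)
    have e2 := hs (l - s) (by omega)
    omega

theorem cut_adjacent {x d : ℕ} (hf : ∀ i < n, f (i + 1) ≤ f i + 1 ∧ f i ≤ f (i + 1) + 1)
    (hx : x + d ≤ n) (h : f x = f (x + d)) :
    ∀ s < n - d, cut f x d (s + 1) ≤ cut f x d s + 1 ∧ cut f x d s ≤ cut f x d (s + 1) + 1 := by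
  intro s hs
  simp only [cut]
  rcases Nat.lt_trichotomy s x with h1 | rfl | h1
  · rw [if_pos (by omega), if_pos (by omega)]
    exact hf s (by omega)
  · rw [if_neg (by omega), if_pos (by omega), h, show s + 1 + d = s + d + 1 by omega]
    exact hf (s + d) (by omega)
  · rw [if_neg (by omega), if_neg (by omega), show s + 1 + d = s + d + 1 by omega]
    exact hf (s + d) (by omega)

theorem exists_cut_eq {x d t : ℕ} (hx : x + d ≤ n) (h : f x = f (x + d)) (ht : t ≤ n)
    (h' : t ≤ x ∨ x + d ≤ t) : ∃ s ≤ n - d, cut f x d s = f t := by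
  by_cases h1 : t ≤ x
  · exact ⟨t, by omega, if_pos h1⟩
  have h2 : x + d ≤ t := by omega
  rcases Nat.lt_or_ge (x + d) t with h3 | h3
  · refine ⟨t - d, by omega, ?_⟩
    simp only [cut]
    rw [if_neg (by omega)]; congr 1; omega
  · obtain rfl : t = x + d := by omega
    exact ⟨x, by omega, by simp [cut, h]⟩

theorem IsWalk.of_stutter (ha : PrimitiveFn a k) (hf : IsWalk a k c n f) (hi : i < n)
    (h : c i = c (i + 1)) : ∃ g, IsWalk a k (cut c i 1) (n - 1) g := by
  have hfi : f i = f (i + 1) := by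
    by_contra hne
    have h1 := hf.adj i hi
    have b1 := hf.le i hi.le
    have b2 := hf.le (i + 1) hi
    rw [hf.eq i hi.le, hf.eq (i + 1) hi] at h
    have : f (i + 1) = f i + 1 ∨ f i = f (i + 1) + 1 := by omega
    rcases this with h2 | h2
    · rw [h2] at h
      exact ha.stutterFree (f i) (by omega) h
    · rw [h2] at h
      exact ha.stutterFree (f (i + 1)) (by omega) h.symm
  refine ⟨cut f i 1, ?_, cut_adjacent hf.adj hi hfi, ?_, ?_⟩
  · intro s hs
    simp only [cut]
    split_ifs <;> exact hf.le _ (by omega)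
  · intro p hp
    obtain ⟨t, ht, rfl⟩ := hf.surj p hp
    exact exists_cut_eq hi hfi ht (by omega)
  · intro s hs
    simp only [cut]
    split_ifs <;> exact hf.eq _ (by omega)

theorem IsWalk.of_start_palindrome (ha : PrimitiveFn a k) (hf : IsWalk a k c n f) (hc : StutterFree c n)
    (hl : 1 ≤ l) (hmin : ∀ m < l, ¬ HasFold c n m) (h : SymAt c n l l) :
    ∃ g, IsWalk a k (fun s => c (s + l)) (n - l) g := by
  have h1 := h.2.1
  have adj : ∀ s < n - l, f (s + 1 + l) ≤ f (s + l) + 1 ∧ f (s + l) ≤ f (s + 1 + l) + 1 := by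
    intro s hs
    rw [show s + 1 + l = s + l + 1 by omega]
    exact hf.adj _ (by omega)
  refine ⟨fun s => f (s + l), fun s hs => hf.le _ (by omega), adj, ?_,
    fun s hs => hf.eq _ (by omega)⟩
  have kept : ∀ t, l ≤ t → t ≤ n → ∃ s ≤ n - l, f (s + l) = f t := by
    intro t h2 h3
    exact ⟨t - l, by omega, by congr 1; omega⟩
  by_cases ht : f (l - 1) = f (l + 1)
  · have sym := (hf.symm_of_turn hc hmin l le_rfl l hl (by omega) ht).2.2
    intro p hp
    obtain ⟨t, htn, rfl⟩ := hf.surj p hp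
    rcases Nat.lt_or_ge t l with h2 | h2
    · have := sym (l - t) (by omega)
      rw [show l - (l - t) = t by omega] at this
      rw [this]
      exact kept _ (by omega) (by omega)
    · exact kept t h2 htn
  · have hs : StraightOn f (l - l) (2 * l) := by
      refine hf.straightOn hc (by omega) ?_
      intro t h2 h3
      by_cases h4 : t = l
      · rw [h4]; exact ht
      · exact hf.not_turn hc hmin h (by omega) (by omega) h4 (by omega) (by omega)
    refine IsWalk.surj_of_straightOn ha hf hl h hs adj (kept l le_rfl (by omega)) (Or.inr ?_)
    intro t htn
    rcases Nat.lt_or_ge t l with h2 | h2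
    · exact Or.inr ⟨l - t, by omega, by omega, by congr 1; omega⟩
    · exact Or.inl (kept t h2 htn)

theorem IsWalk.of_last_palindrome (ha : PrimitiveFn a k) (hf : IsWalk a k c n f) (hc : StutterFree c n)
    (hl : 1 ≤ l) (hmin : ∀ m < l, ¬ HasFold c n m) (h : SymAt c n (n - l) l) :
    ∃ g, IsWalk a k c (n - l) g := by
  have h0 := h.1
  have h1 := h.2.1
  have adj : ∀ s < n - l, f (s + 1) ≤ f s + 1 ∧ f s ≤ f (s + 1) + 1 :=
    fun s hs => hf.adj _ (by omega)
  refine ⟨f, fun s hs => hf.le _ (by omega), adj, ?_, fun s hs => hf.eq _ (by omega)⟩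
  by_cases ht : f (n - l - 1) = f (n - l + 1)
  · have sym := (hf.symm_of_turn hc hmin l le_rfl (n - l) (by omega) (by omega) ht).2.2
    intro p hp
    obtain ⟨t, htn, rfl⟩ := hf.surj p hp
    rcases Nat.lt_or_ge (n - l) t with h2 | h2
    · have := sym (t - (n - l)) (by omega)
      rw [show n - l + (t - (n - l)) = t by omega] at this
      exact ⟨_, by omega, this⟩
    · exact ⟨t, h2, rfl⟩
  · have hs : StraightOn f (n - l - l) (2 * l) := by
      refine hf.straightOn hc (by omega) ?_
      intro t h2 h3
      by_cases h4 : t = n - l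
      · rw [h4]; exact ht
      · exact hf.not_turn hc hmin h (by omega) (by omega) h4 (by omega) (by omega)
    refine IsWalk.surj_of_straightOn ha hf hl h hs adj ⟨n - l, le_rfl, rfl⟩ (Or.inl ?_)
    intro t htn
    rcases Nat.lt_or_ge (n - l) t with h2 | h2
    · exact Or.inr ⟨t - (n - l), by omega, by omega, by congr 1; omega⟩
    · exact Or.inl ⟨t, h2, rfl⟩

theorem IsWalk.of_zigzag (ha : PrimitiveFn a k) (hf : IsWalk a k c n f) (hc : StutterFree c n)
    (hl : 1 ≤ l) (hmin : ∀ m < l, ¬ HasFold c n m) (hi : SymAt c n i l)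
    (hj : SymAt c n (i + l) l) : ∃ g, IsWalk a k (cut c i (2 * l)) (n - 2 * l) g := by
  have h0 := hi.1
  have h1 := hj.2.1
  have noturn : ∀ t, i - l < t → t < i + 2 * l → t ≠ i → t ≠ i + l → f (t - 1) ≠ f (t + 1) := by
    intro t h2 h3 h4 h5
    by_cases h6 : t < i + l
    · exact hf.not_turn hc hmin hi (by omega) (by omega) h4 (by omega) (by omega)
    · exact hf.not_turn hc hmin hj (by omega) (by omega) h5 (by omega) (by omega)
  have straight_i : f (i - 1) ≠ f (i + 1) → StraightOn f (i - l) (2 * l) := by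
    intro ht
    refine hf.straightOn hc (by omega) ?_
    intro t h2 h3
    by_cases h4 : t = i
    · rw [h4]; exact ht
    · exact noturn t (by omega) (by omega) h4 (by omega)
  have straight_j : f (i + l - 1) ≠ f (i + l + 1) → StraightOn f (i + l - l) (2 * l) := by
    intro ht
    refine hf.straightOn hc (by omega) ?_
    intro t h2 h3
    by_cases h4 : t = i + l
    · rw [h4]; exact ht
    · exact noturn t (by omega) (by omega) (by omega) h4
  by_cases htj : f (i + l - 1) = f (i + l + 1)
  · have symj := (hf.symm_of_turn hc hmin l le_rfl (i + l) (by omega) (by omega) htj).2.2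
    have hcut : f i = f (i + 2 * l) := by
      have := symj l le_rfl
      rw [show i + l - l = i by omega, show i + l + l = i + 2 * l by omega] at this
      exact this
    have adj := cut_adjacent hf.adj (by omega) hcut
    have kept := fun t ht h' => exists_cut_eq (n := n) (t := t) (by omega) hcut ht h'
    refine ⟨cut f i (2 * l), ?_, adj, ?_, ?_⟩
    · intro s hs
      simp only [cut]
      split_ifs <;> exact hf.le _ (by omega)
    · have lost : ∀ t, i < t → t < i + 2 * l → ∃ s, 1 ≤ s ∧ s ≤ l ∧ f t = f (i + s) := by
        intro t h2 h3
        rcases Nat.lt_or_ge (i + l) t with h4 | h4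
        · refine ⟨i + 2 * l - t, by omega, by omega, ?_⟩
          have := symj (t - (i + l)) (by omega)
          rw [show i + l + (t - (i + l)) = t by omega] at this
          rw [← this]; congr 1; omega
        · exact ⟨t - i, by omega, by omega, by congr 1; omega⟩
      by_cases hti : f (i - 1) = f (i + 1)
      · have symi := (hf.symm_of_turn hc hmin l le_rfl i (by omega) (by omega) hti).2.2
        intro p hp
        obtain ⟨t, htn, rfl⟩ := hf.surj p hp
        by_cases h2 : t ≤ i ∨ i + 2 * l ≤ t
        · exact kept t htn h2
        · obtain ⟨s, h3, h4, h5⟩ := lost t (by omega) (by omega)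
          rw [h5, ← symi s h4]
          exact kept _ (by omega) (by omega)
      · refine IsWalk.surj_of_straightOn ha hf hl hi (straight_i hti) adj
          (kept i (by omega) (by omega)) (Or.inl ?_)
        intro t htn
        by_cases h2 : t ≤ i ∨ i + 2 * l ≤ t
        · exact Or.inl (kept t htn h2)
        · exact Or.inr (lost t (by omega) (by omega))
    · intro s hs
      simp only [cut]
      split_ifs <;> exact hf.eq _ (by omega)
  · by_cases hti : f (i - 1) = f (i + 1)
    · have symi := (hf.symm_of_turn hc hmin l le_rfl i (by omega) (by omega) hti).2.2
      have hcut : f (i - l) = f (i - l + 2 * l) := by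
        rw [symi l le_rfl]; congr 1; omega
      have adj := cut_adjacent hf.adj (by omega) hcut
      have kept := fun t ht h' => exists_cut_eq (n := n) (t := t) (by omega) hcut ht h'
      refine ⟨cut f (i - l) (2 * l), ?_, adj, ?_, ?_⟩
      · intro s hs
        simp only [cut]
        split_ifs <;> exact hf.le _ (by omega)
      · refine IsWalk.surj_of_straightOn ha hf hl hj (straight_j htj) adj
          (kept (i + l) (by omega) (by omega)) (Or.inr ?_)
        intro t htn
        by_cases h2 : t ≤ i - l ∨ i - l + 2 * l ≤ t
        · exact Or.inl (kept t htn h2)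
        · right
          rcases Nat.lt_or_ge t i with h4 | h4
          · refine ⟨l - (i - t), by omega, by omega, ?_⟩
            have := symi (i - t) (by omega)
            rw [show i - (i - t) = t by omega] at this
            rw [this]; congr 1; omega
          · exact ⟨i + l - t, by omega, by omega, by congr 1; omega⟩
      · intro s hs
        simp only [cut]
        split_ifs with h2 h3 h3
        · exact hf.eq _ (by omega)
        · have := hi.periodic hj (s := i - s) (by omega)
          rw [show i - (i - s) = s by omega] at this
          rw [this]
          exact hf.eq _ (by omega)
        · omega
        · exact hf.eq _ (by omega)
    · exfalso
      have si := hf.symAt_of_straightOn hi (straight_i hti)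
      have sj := hf.symAt_of_straightOn hj (straight_j htj)
      rcases straight_j htj with h2 | h2
      · have := h2 l (by omega)
        rw [show i + l - l = i by omega] at this
        rw [this] at sj
        exact ha.not_zigzag hl si sj
      · have := h2 l (by omega)
        rw [show i + l - l = i by omega] at this
        rw [← this] at si
        exact ha.not_zigzag hl sj si

/-- A word with a stutter or a fold can be shortened without losing any primitive generator. -/
theorem exists_shorter (h : ¬ (StutterFree c n ∧ ∀ m, ¬ HasFold c n m)) :
    ∃ (c' : ℕ → A) (n' : ℕ), n' < n ∧ ∀ (a : ℕ → A) (k : ℕ), PrimitiveFn a k →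
      (∃ f, IsWalk a k c n f) → ∃ g, IsWalk a k c' n' g := by
  classical
  by_cases hc : StutterFree c n
  · have hex : ∃ m, HasFold c n m := by
      by_contra! hcon
      exact h ⟨hc, hcon⟩
    have hmin : ∀ m < Nat.find hex, ¬ HasFold c n m := fun m hm => Nat.find_min hex hm
    obtain ⟨hl, hfold⟩ := Nat.find_spec hex
    rcases hfold with hs | hs | ⟨i, hi, hj⟩
    · refine ⟨_, _, ?_, fun a k ha ⟨f, hf⟩ => hf.of_start_palindrome ha hc hl hmin hs⟩
      have := hs.2.1
      omega
    · refine ⟨_, _, ?_, fun a k ha ⟨f, hf⟩ => hf.of_last_palindrome ha hc hl hmin hs⟩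
      have := hs.2.1
      omega
    · refine ⟨_, _, ?_, fun a k ha ⟨f, hf⟩ => hf.of_zigzag ha hc hl hmin hi hj⟩
      have := hj.2.1
      omega
  · simp only [StutterFree, not_forall, not_not] at hc
    obtain ⟨i, hi, heq⟩ := hc
    exact ⟨_, _, by omega, fun a k ha ⟨f, hf⟩ => hf.of_stutter ha hi heq⟩

theorem IsWalk.eq_or_reverse (hf : IsWalk a k c n f) (hc : StutterFree c n)
    (hfold : ∀ m, ¬ HasFold c n m) :
    k = n ∧ ((∀ i ≤ n, a i = c i) ∨ ∀ i ≤ n, a i = c (n - i)) := by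
  have hs : StraightOn f 0 n := by
    refine hf.straightOn hc (by omega) ?_
    intro t h1 h2 h3
    have := (hf.symAt_of_turn hc (l := n + 1) (fun m _ => hfold m) h1 (by omega) h3).2.1
    omega
  obtain ⟨x, hx, hx0⟩ := hf.surj 0 (by omega)
  obtain ⟨y, hy, hyk⟩ := hf.surj k le_rfl
  have b0 := hf.le 0 (by omega)
  have bn := hf.le n le_rfl
  rcases hs with hs | hs <;> simp only [Nat.zero_add] at hs
  · have e1 := hs x hx
    have e2 := hs y hy
    have e3 := hs n le_rfl
    refine ⟨by omega, Or.inl fun i hi => ?_⟩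
    rw [hf.eq i hi]
    have := hs i hi
    congr 1; omega
  · have e1 := hs x hx
    have e2 := hs y hy
    have e3 := hs n le_rfl
    refine ⟨by omega, Or.inr fun i hi => ?_⟩
    rw [hf.eq (n - i) (by omega)]
    have := hs (n - i) (by omega)
    congr 1; omega

theorem PrimitiveFn.eq_or_reverse (ha : PrimitiveFn a k) (hb : PrimitiveFn b l) :
    ∀ (n : ℕ) (c : ℕ → A), (∃ f, IsWalk a k c n f) → (∃ g, IsWalk b l c n g) →
      k = l ∧ ((∀ i ≤ k, b i = a i) ∨ ∀ i ≤ k, b i = a (k - i)) := by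
  intro n
  induction n using Nat.strong_induction_on with
  | _ n ih =>
    intro c hfa hgb
    by_cases h : StutterFree c n ∧ ∀ m, ¬ HasFold c n m
    · obtain ⟨f, hf⟩ := hfa
      obtain ⟨g, hg⟩ := hgb
      obtain ⟨rfl, h1⟩ := hf.eq_or_reverse h.1 h.2
      obtain ⟨rfl, h2⟩ := hg.eq_or_reverse h.1 h.2
      refine ⟨rfl, ?_⟩
      rcases h1 with h1 | h1 <;> rcases h2 with h2 | h2
      · exact Or.inl fun i hi => by rw [h1 i hi, h2 i hi]
      · exact Or.inr fun i hi => by rw [h1 _ (by omega), h2 i hi]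
      · refine Or.inr fun i hi => ?_
        rw [h1 _ (by omega), h2 i hi]; congr 1; omega
      · exact Or.inl fun i hi => by rw [h1 i hi, h2 i hi]
    · obtain ⟨c', n', hn, hc'⟩ := exists_shorter h
      exact ih n' hn c' (hc' a k ha hfa) (hc' b l hb hgb)

end Words

section Lists

variable {A : Type*}

theorem Generates.exists_isWalk {a c : List A} (x : A) (hc : c ≠ []) (h : Generates a c) :
    a ≠ [] ∧ ∃ f, IsWalk (fun i => a.getD i x) (a.length - 1) (fun i => c.getD i x)
      (c.length - 1) f := by
  obtain ⟨f, hadj, hsurj, heq⟩ := h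
  have hpos := List.length_pos_iff.mpr hc
  have hapos : 0 < a.length := (f ⟨0, hpos⟩).pos
  refine ⟨List.length_pos_iff.mp hapos,
    fun i => if h : i < c.length then f ⟨i, h⟩ else 0, ?_, ?_, ?_, ?_⟩
  · intro i hi
    have h : i < c.length := by omega
    simp only [h, dif_pos]
    have := (f ⟨i, h⟩).isLt
    omega
  · intro i hi
    have h : i + 1 < c.length := by omega
    have h' : i < c.length := by omega
    simp only [h, h', dif_pos]
    have := abs_le.mp (hadj i h)
    omega
  · intro p hp
    obtain ⟨⟨i, hi⟩, h⟩ := hsurj ⟨p, by omega⟩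
    refine ⟨i, by omega, ?_⟩
    simp only [hi, dif_pos, h]
  · intro i hi
    have h : i < c.length := by omega
    simp only [h, dif_pos]
    rw [List.getD_eq_getElem _ _ h, List.getD_eq_getElem _ _ (f ⟨i, h⟩).isLt]
    have := List.getElem_of_eq heq h
    rw [this, List.getElem_ofFn, List.get_eq_getElem]

theorem Primitive.primitiveFn {a : List A} (x : A) (ha : a ≠ []) (h : Primitive a) :
    PrimitiveFn (fun i => a.getD i x) (a.length - 1) := by
  intro b l f hf
  by_contra! hlt
  have hpos := List.length_pos_iff.mpr ha
  refine h ⟨List.ofFn fun i : Fin (l + 1) => b i, by rw [List.length_ofFn]; omega,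
    fun i => ⟨f i, ?_⟩, ?_, ?_, ?_⟩
  · rw [List.length_ofFn]
    have := hf.le i (by omega)
    omega
  · intro i hi
    have := hf.adj i (by omega)
    rw [abs_le]
    dsimp only
    omega
  · rintro ⟨p, hp⟩
    rw [List.length_ofFn] at hp
    obtain ⟨i, hi, h⟩ := hf.surj p (by omega)
    exact ⟨⟨i, by omega⟩, Fin.ext h⟩
  · refine List.ext_getElem (by simp) ?_
    intro i h1 h2
    have := hf.eq i (by omega)
    simp only [List.getD_eq_getElem _ _ h1] at this
    simp only [this, List.get_eq_getElem, List.getElem_ofFn]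

end Lists

/-- Uniqueness of primitive generators: any two primitive generators of the
same word are equal or mutually reversed. -/
theorem primitive_generator_unique {A : Type*} (c a b : List A)
    (ha : PrimitiveGenerator a c) (hb : PrimitiveGenerator b c) :
    b = a ∨ b = a.reverse := by
  rcases c with _ | ⟨x, c⟩
  · have nil : ∀ d : List A, Generates d [] → d = [] := by
      rintro d ⟨f, -, hs, -⟩
      by_contra hd
      obtain ⟨i, -⟩ := hs ⟨0, List.length_pos_iff.mpr hd⟩
      exact i.elim0
    left
    rw [nil a ha.2, nil b hb.2]
  · obtain ⟨ha0, hwa⟩ := ha.2.exists_isWalk x (by simp)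
    obtain ⟨hb0, hwb⟩ := hb.2.exists_isWalk x (by simp)
    have pa := List.length_pos_iff.mpr ha0
    have pb := List.length_pos_iff.mpr hb0
    obtain ⟨hlen, h⟩ := (ha.1.primitiveFn x ha0).eq_or_reverse (hb.1.primitiveFn x hb0) _ _ hwa hwb
    refine h.imp ?_ ?_
    · intro h
      refine List.ext_getElem (by omega) ?_
      intro i h1 h2
      have := h i (by omega)
      simpa only [List.getD_eq_getElem _ _ h1, List.getD_eq_getElem _ _ h2] using this
    · intro h
      refine List.ext_getElem (by rw [List.length_reverse]; omega) ?_
      intro i h1 h2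
      have := h i (by omega)
      rw [List.getElem_reverse]
      simpa only [List.getD_eq_getElem _ _ h1,
        List.getD_eq_getElem _ _ (show a.length - 1 - i < a.length by omega)] using this
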